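/- Let m be an odd positive integer and let ℓ_m be the minimal degree of the irreducible factors in (Z/2)[X] of (X^m − 1)/(X − 1). Then the number of pairs (a(X), b(X)) ∈ J_m × J_m with dim C_{a,b} = m − 1 is at least 2^{2(m−1)} · (1 − 2^{−2ℓ_m})^{m/ℓ_m}, where the exponent m/ℓ_m is a real number. -/

import Mathlib

open Polynomial

noncomputable section

/-- The polynomial `X^m - 1` over `Z/2`. -/
def fm (m : ℕ) : Polynomial (ZMod 2) := X ^ m - 1

/-- The polynomial `X^m - 1` over `Z/4`. -/
def fm4 (m : ℕ) : Polynomial (ZMod 4) := X ^ m - 1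

/-- `R_m = (Z/2)[X]/⟨X^m - 1⟩`. -/
abbrev R2 (m : ℕ) : Type := Polynomial (ZMod 2) ⧸ Ideal.span {fm m}

/-- `R'_m = (Z/4)[X]/⟨X^m - 1⟩`. -/
abbrev R4 (m : ℕ) : Type := Polynomial (ZMod 4) ⧸ Ideal.span {fm4 m}

def mk2 (m : ℕ) : Polynomial (ZMod 2) →+* R2 m := Ideal.Quotient.mk _

def mk4 (m : ℕ) : Polynomial (ZMod 4) →+* R4 m := Ideal.Quotient.mk _

/-- The canonical representative (of degree `< m`) of an element of `R2 m`. -/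
def rep2 (m : ℕ) (r : R2 m) : Polynomial (ZMod 2) :=
  (Function.surjInv (Ideal.Quotient.mk_surjective (I := Ideal.span {fm m})) r) %ₘ fm m

/-- The canonical representative (of degree `< m`) of an element of `R4 m`. -/
def rep4 (m : ℕ) (r : R4 m) : Polynomial (ZMod 4) :=
  (Function.surjInv (Ideal.Quotient.mk_surjective (I := Ideal.span {fm4 m})) r) %ₘ fm4 m

/-- Coefficientwise doubling map `(Z/2)[X] → (Z/4)[X]`, `a ↦ 2a` on each coefficient. -/
def polyDbl (p : Polynomial (ZMod 2)) : Polynomial (ZMod 4) :=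
  ∑ i ∈ p.support, Polynomial.C (2 * ((p.coeff i).val : ZMod 4)) * X ^ i

/-- The additive embedding `R_m → R'_m`, `f ↦ 2f`. -/
def iota (m : ℕ) (r : R2 m) : R4 m := mk4 m (polyDbl (rep2 m r))

/-- Hamming weight of an element of `R_m` (of its coefficient vector). -/
def wt2 (m : ℕ) (r : R2 m) : ℕ := (rep2 m r).support.card

/-- Lee weight of an element of `Z/4`. -/
def lee (x : ZMod 4) : ℕ := min x.val (4 - x.val)

/-- Lee weight of an element of `R'_m` (of its coefficient vector). -/
def wtLee (m : ℕ) (r : R4 m) : ℕ := ∑ i ∈ (rep4 m r).support, lee ((rep4 m r).coeff i)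

/-- The augmentation ideal `J_m = ⟨X - 1⟩` of `R_m`. -/
def Jm (m : ℕ) : Ideal (R2 m) := Ideal.span {mk2 m (X - 1)}

/-- The `Z2Z4`-additive cyclic code `C_{a,b} = {(f·a, 2(f·b)) : f ∈ R_m}`. -/
def Cab (m : ℕ) (a b : R2 m) : Set (R2 m × R4 m) :=
  {w | ∃ f : R2 m, w = (f * a, iota m (f * b))}

/-- Dimension of `C_{a,b}` as a vector space over `Z/2`, i.e. `log₂ |C_{a,b}|`. -/
def dimCab (m : ℕ) (a b : R2 m) : ℕ := Nat.log 2 (Nat.card (Cab m a b))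

/-- `(X^m - 1)/(X - 1) = X^{m-1} + ⋯ + X + 1` over `Z/2`. -/
def geomPoly (m : ℕ) : Polynomial (ZMod 2) := ∑ i ∈ Finset.range m, X ^ i

/-- `ℓ_m`: minimal degree of the irreducible factors of `(X^m-1)/(X-1)` in `(Z/2)[X]`. -/
def ell (m : ℕ) : ℕ :=
  sInf {d | ∃ p : Polynomial (ZMod 2), Irreducible p ∧ p ∣ geomPoly m ∧ p.natDegree = d}

/-- The binary entropy function `H(x) = -x·log₂x - (1-x)·log₂(1-x)`. -/
def Hent (x : ℝ) : ℝ := -(x * Real.logb 2 x) - (1 - x) * Real.logb 2 (1 - x)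


lemma geom_mul (m : ℕ) : geomPoly m * (X - 1) = fm m := geom_sum_mul X m

lemma geom_monic (m : ℕ) (h : 0 < m) : (geomPoly m).Monic := monic_geom_sum_X h.ne'

lemma fm_monic (m : ℕ) (h : 0 < m) : (fm m).Monic := monic_X_pow_sub_C 1 h.ne'

lemma fm4_monic (m : ℕ) (h : 0 < m) : (fm4 m).Monic := monic_X_pow_sub_C 1 h.ne'

lemma geom_natDegree (m : ℕ) (h : 0 < m) : (geomPoly m).natDegree = m - 1 := by
  have h1 := congrArg natDegree (geom_mul m)
  have h2 : (fm m).natDegree = m := natDegree_X_pow_sub_C (r := (1 : ZMod 2))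
  have h3 : (X - 1 : (ZMod 2)[X]).natDegree = 1 := natDegree_X_sub_C 1
  have h4 : (X - 1 : (ZMod 2)[X]).Monic := monic_X_sub_C (1 : ZMod 2)
  rw [(geom_monic m h).natDegree_mul h4, h2] at h1
  omega

/-- quotient by the geometric polynomial -/
abbrev Sq (m : ℕ) : Type := Polynomial (ZMod 2) ⧸ Ideal.span {geomPoly m}

lemma finite_quot (p : (ZMod 2)[X]) (hp : p ≠ 0) :
    Finite ((ZMod 2)[X] ⧸ Ideal.span {p}) := by
  have : Module.Finite (ZMod 2) ((ZMod 2)[X] ⧸ Ideal.span {p}) :=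
    (AdjoinRoot.powerBasis hp).finite
  exact Module.finite_of_finite (ZMod 2)

lemma card_quot (p : (ZMod 2)[X]) (hp : p ≠ 0) :
    Nat.card ((ZMod 2)[X] ⧸ Ideal.span {p}) = 2 ^ p.natDegree := by
  have : Module.Finite (ZMod 2) ((ZMod 2)[X] ⧸ Ideal.span {p}) :=
    (AdjoinRoot.powerBasis hp).finite
  rw [Module.natCard_eq_pow_finrank (K := ZMod 2), Nat.card_zmod,
    finrank_quotient_span_eq_natDegree]

lemma mk_eq_iff (g p q : (ZMod 2)[X]) :
    (Ideal.Quotient.mk (Ideal.span {g}) p = Ideal.Quotient.mk (Ideal.span {g}) q) ↔ g ∣ p - q := by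
  rw [Ideal.Quotient.eq, Ideal.mem_span_singleton]

lemma sq_reduced (m : ℕ) (hm : Odd m) : IsReduced (Sq m) := by
  have h1 : (fm m).Separable := by
    refine X_pow_sub_one_separable_iff.2 ?_
    rw [Ne, ZMod.natCast_eq_zero_iff]
    intro h
    exact (Nat.not_even_iff_odd.2 hm) (even_iff_two_dvd.2 h)
  have h2 : Squarefree (geomPoly m) :=
    h1.squarefree.squarefree_of_dvd ⟨_, (geom_mul m).symm⟩
  refine ⟨fun x hx => ?_⟩
  obtain ⟨n, hn⟩ := hx
  obtain ⟨p, rfl⟩ := Ideal.Quotient.mk_surjective x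
  rw [← map_pow, Ideal.Quotient.eq_zero_iff_dvd] at hn
  rw [Ideal.Quotient.eq_zero_iff_dvd]
  exact h2.isRadical n p hn

lemma mk2_rep2 (m : ℕ) (r : R2 m) : mk2 m (rep2 m r) = r := by
  have h := Function.surjInv_eq
    (Ideal.Quotient.mk_surjective (I := Ideal.span {fm m})) r
  conv_rhs => rw [← h]
  unfold rep2 mk2
  rw [mk_eq_iff]
  set q := Function.surjInv (Ideal.Quotient.mk_surjective (I := Ideal.span {fm m})) r
  refine ⟨-(q /ₘ fm m), ?_⟩
  have := modByMonic_add_div q (fm m)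
  linear_combination this

lemma coeff_polyDbl (p : (ZMod 2)[X]) (i : ℕ) :
    (polyDbl p).coeff i = 2 * ((p.coeff i).val : ZMod 4) := by
  unfold polyDbl
  simp only [finsetSum_coeff, coeff_C_mul_X_pow]
  rw [Finset.sum_ite_eq]
  split_ifs with h
  · rfl
  · rw [notMem_support_iff.1 h]; simp

lemma polyDbl_inj (p q : (ZMod 2)[X]) (h : polyDbl p = polyDbl q) : p = q := by
  ext i
  have := congrArg (fun r => r.coeff i) h
  simp only [coeff_polyDbl] at this
  generalize p.coeff i = a at *
  generalize q.coeff i = b at *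
  revert a b
  decide

lemma degree_polyDbl (p : (ZMod 2)[X]) (m : ℕ) (h : p.degree < m) : (polyDbl p).degree < m := by
  rw [degree_lt_iff_coeff_zero] at h ⊢
  intro i hi
  rw [coeff_polyDbl, h i hi]; simp

lemma iota_inj (m : ℕ) (h : 0 < m) (r s : R2 m) (e : iota m r = iota m s) : r = s := by
  have hd : ∀ r, (polyDbl (rep2 m r)).degree < m := fun r => by
    apply degree_polyDbl
    have := degree_modByMonic_lt (Function.surjInv
      (Ideal.Quotient.mk_surjective (I := Ideal.span {fm m})) r) (fm_monic m h)
    rwa [show (fm m).degree = m from degree_X_pow_sub_C h (1 : ZMod 2)] at this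
  have e2 : fm4 m ∣ polyDbl (rep2 m r) - polyDbl (rep2 m s) := by
    unfold iota mk4 at e
    rwa [Ideal.Quotient.eq, Ideal.mem_span_singleton] at e
  have e3 : polyDbl (rep2 m r) - polyDbl (rep2 m s) = 0 := by
    by_contra hne
    have : Fact (1 < 4) := ⟨by norm_num⟩
    have : Nontrivial (ZMod 4) := ZMod.nontrivial 4
    refine (fm4_monic m h).not_dvd_of_degree_lt hne ?_ e2
    rw [show (fm4 m).degree = m from degree_X_pow_sub_C h (1 : ZMod 4)]
    exact lt_of_le_of_lt (degree_sub_le _ _) (max_lt (hd r) (hd s))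
  have e4 := polyDbl_inj _ _ (sub_eq_zero.1 e3)
  rw [← mk2_rep2 m r, e4, mk2_rep2]

/-- chosen lift -/
def lft (m : ℕ) (s : Sq m) : (ZMod 2)[X] :=
  Function.surjInv (Ideal.Quotient.mk_surjective (I := Ideal.span {geomPoly m})) s

lemma mk_lft (m : ℕ) (s : Sq m) : Ideal.Quotient.mk (Ideal.span {geomPoly m}) (lft m s) = s :=
  Function.surjInv_eq _ s

/-- the embedding of `Sq m` onto `Jm m` -/
def psi (m : ℕ) (s : Sq m) : R2 m := mk2 m ((X - 1) * lft m s)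

lemma psi_mem (m : ℕ) (s : Sq m) : psi m s ∈ Jm m := by
  unfold psi Jm
  rw [map_mul]
  exact Ideal.mul_mem_right _ _ (Ideal.mem_span_singleton_self _)

lemma key_iff (m : ℕ) (u v : (ZMod 2)[X]) (c : Sq m) :
    mk2 m u * psi m c = mk2 m v * psi m c ↔
      Ideal.Quotient.mk (Ideal.span {geomPoly m}) u * c
        = Ideal.Quotient.mk (Ideal.span {geomPoly m}) v * c := by
  conv_rhs => rw [← mk_lft m c]
  unfold psi
  rw [← map_mul, ← map_mul, ← map_mul, ← map_mul]
  unfold mk2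
  rw [mk_eq_iff, mk_eq_iff, ← geom_mul]
  have : (X - 1 : (ZMod 2)[X]) ≠ 0 := (monic_X_sub_C (1 : ZMod 2)).ne_zero
  rw [show u * ((X - 1) * lft m c) - v * ((X - 1) * lft m c)
    = (u * lft m c - v * lft m c) * (X - 1) by ring]
  exact mul_dvd_mul_iff_right this

lemma psi_inj (m : ℕ) : Function.Injective (psi m) := by
  intro s t e
  unfold psi mk2 at e
  rw [mk_eq_iff, ← geom_mul, ← mul_sub, mul_comm (X - 1)] at e
  have : (X - 1 : (ZMod 2)[X]) ≠ 0 := (monic_X_sub_C (1 : ZMod 2)).ne_zero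
  rw [mul_dvd_mul_iff_right this, ← mk_eq_iff, mk_lft, mk_lft] at e
  exact e

lemma card_Cab (m : ℕ) (h : 0 < m) (c d : Sq m) (hcd : IsCoprime c d) :
    dimCab m (psi m c) (psi m d) = m - 1 := by
  have hc : Nat.card (Cab m (psi m c) (psi m d)) = Nat.card (Sq m) := by
    symm
    refine Nat.card_congr (Equiv.ofBijective (fun s : Sq m =>
      (⟨(mk2 m (lft m s) * psi m c, iota m (mk2 m (lft m s) * psi m d)), _, rfl⟩ :
        Cab m (psi m c) (psi m d))) ⟨?_, ?_⟩)
    · intro s t e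
      have e := congrArg Subtype.val e
      have e1 := congrArg Prod.fst e
      have e2 := iota_inj m h _ _ (congrArg Prod.snd e)
      simp only at e1
      rw [key_iff, mk_lft, mk_lft] at e1 e2
      obtain ⟨x, y, hxy⟩ := hcd
      linear_combination x * e1 + y * e2 + (t - s) * hxy
    · rintro ⟨w, f, rfl⟩
      obtain ⟨F, rfl⟩ : ∃ F, mk2 m F = f := Ideal.Quotient.mk_surjective f
      refine ⟨Ideal.Quotient.mk (Ideal.span {geomPoly m}) F, ?_⟩
      apply Subtype.ext
      have h1 : ∀ c : Sq m, mk2 m (lft m (Ideal.Quotient.mk (Ideal.span {geomPoly m}) F)) * psi m c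
          = mk2 m F * psi m c := fun c => by
        rw [key_iff, mk_lft]
      simp only [h1]
  unfold dimCab
  rw [hc, card_quot _ (geom_monic m h).ne_zero, geom_natDegree m h, Nat.log_pow (by norm_num)]

lemma residue_card (m : ℕ) (h : 0 < m) (I : MaximalSpectrum (Sq m)) :
    ∃ p : (ZMod 2)[X], Irreducible p ∧ p ∣ geomPoly m ∧
      Nat.card (Sq m ⧸ I.asIdeal) = 2 ^ p.natDegree := by
  have hI := I.isMaximal
  let φ : (ZMod 2)[X] →+* Sq m ⧸ I.asIdeal :=
    (Ideal.Quotient.mk I.asIdeal).comp (Ideal.Quotient.mk (Ideal.span {geomPoly m}))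
  have hφ : Function.Surjective φ :=
    Ideal.Quotient.mk_surjective.comp Ideal.Quotient.mk_surjective
  letI := Ideal.Quotient.field I.asIdeal
  have hker : (RingHom.ker φ).IsPrime := RingHom.ker_isPrime φ
  obtain ⟨p, hp⟩ := (IsPrincipalIdealRing.principal (RingHom.ker φ)).principal
  rw [Ideal.submodule_span_eq] at hp
  have hdvd : p ∣ geomPoly m := by
    rw [← Ideal.mem_span_singleton, ← hp, RingHom.mem_ker]
    simp only [φ, RingHom.comp_apply]
    rw [Ideal.Quotient.eq_zero_iff_dvd _ _ |>.2 dvd_rfl, map_zero]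
  have hp0 : p ≠ 0 := by
    rintro rfl
    exact (geom_monic m h).ne_zero (zero_dvd_iff.1 hdvd)
  refine ⟨p, ?_, hdvd, ?_⟩
  · rw [hp, Ideal.span_singleton_prime hp0] at hker
    exact hker.irreducible
  · rw [← card_quot p hp0, ← hp]
    exact (Nat.card_congr (RingHom.quotientKerEquivOfSurjective hφ).toEquiv).symm

lemma ell_le (m : ℕ) (p : (ZMod 2)[X]) (h1 : Irreducible p) (h2 : p ∣ geomPoly m) :
    ell m ≤ p.natDegree := Nat.sInf_le ⟨p, h1, h2, rfl⟩

lemma ell_pos (m : ℕ) (p : (ZMod 2)[X]) (h1 : Irreducible p) (h2 : p ∣ geomPoly m) :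
    0 < ell m := by
  obtain ⟨q, hq, -, hd⟩ := Nat.sInf_mem (s := {d | ∃ p : Polynomial (ZMod 2), Irreducible p ∧
    p ∣ geomPoly m ∧ p.natDegree = d}) ⟨_, p, h1, h2, rfl⟩
  unfold ell
  rw [← hd]
  exact hq.natDegree_pos

lemma coprime_of_pi {ι : Type*} {K : ι → Type*} [∀ i, Field (K i)] (a b : ∀ i, K i)
    (h : ∀ i, (a i, b i) ≠ 0) : IsCoprime a b := by
  have : ∀ i, ∃ x y, x * a i + y * b i = 1 := by
    intro i
    by_cases ha : a i = 0
    · have hb : b i ≠ 0 := fun hb => h i (by simp [ha, hb])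
      exact ⟨0, (b i)⁻¹, by simp [hb]⟩
    · exact ⟨(a i)⁻¹, 0, by simp [ha]⟩
  choose x y hxy using this
  exact ⟨x, y, funext hxy⟩

/-- The number of pairs `(a,b) ∈ J_m × J_m` with `dim C_{a,b} = m - 1`
is at least `2^{2(m-1)} · (1 - 2^{-2ℓ_m})^{m/ℓ_m}` (real exponent `m/ℓ_m`). -/
theorem statement14 (m : ℕ) (hm : Odd m) (hmpos : 0 < m) :
    (2 : ℝ) ^ (2 * (m - 1) : ℕ) *
        (1 - (2 : ℝ) ^ (-(2 * (ell m : ℝ)))) ^ ((m : ℝ) / (ell m : ℝ))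
      ≤ (Nat.card {w : R2 m × R2 m // w.1 ∈ Jm m ∧ w.2 ∈ Jm m ∧
          dimCab m w.1 w.2 = m - 1} : ℝ) := by
  classical
  have hfS : Finite (Sq m) := finite_quot _ (geom_monic m hmpos).ne_zero
  have hfR : Finite (R2 m) := finite_quot _ (fm_monic m hmpos).ne_zero
  have hred := sq_reduced m hm
  have hfM : Finite (MaximalSpectrum (Sq m)) := inferInstance
  letI := Fintype.ofFinite (MaximalSpectrum (Sq m))
  letI hfield : ∀ I : MaximalSpectrum (Sq m), Field (Sq m ⧸ I.asIdeal) := fun I =>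
    haveI := I.isMaximal
    Ideal.Quotient.field I.asIdeal
  have hfK : ∀ I : MaximalSpectrum (Sq m), Finite (Sq m ⧸ I.asIdeal) := fun I =>
    Finite.of_surjective _ Ideal.Quotient.mk_surjective
  let e := (IsArtinianRing.equivPi (Sq m)).toRingEquiv
  choose p hirr hdvd hcard using residue_card m hmpos
  -- the product of the residue cardinalities
  have hprod : ∏ I, 2 ^ (p I).natDegree = 2 ^ (m - 1) := by
    rw [← geom_natDegree m hmpos, ← card_quot _ (geom_monic m hmpos).ne_zero,
      Nat.card_congr e.toEquiv, Nat.card_pi]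
    exact Finset.prod_congr rfl fun I _ => (hcard I).symm
  have hsum : ∑ I, (p I).natDegree = m - 1 := by
    rw [Finset.prod_pow_eq_pow_sum] at hprod
    exact Nat.pow_right_injective le_rfl hprod
  -- the injection
  let T := ∀ I : MaximalSpectrum (Sq m),
    {w : (Sq m ⧸ I.asIdeal) × (Sq m ⧸ I.asIdeal) // w ≠ 0}
  have hT : Nat.card T = ∏ I, ((2 ^ (p I).natDegree) ^ 2 - 1) := by
    rw [Nat.card_pi]
    refine Finset.prod_congr rfl fun I _ => ?_
    letI := Fintype.ofFinite (Sq m ⧸ I.asIdeal)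
    rw [← hcard I, Nat.card_eq_fintype_card, Nat.card_eq_fintype_card, Fintype.card_subtype_compl,
      Fintype.card_prod, Fintype.card_subtype_eq, sq]
  let A : T → Sq m := fun t => e.symm fun I => (t I).1.1
  let B : T → Sq m := fun t => e.symm fun I => (t I).1.2
  have hAB : ∀ t, IsCoprime (A t) (B t) := fun t =>
    (coprime_of_pi (fun I => (t I).1.1) (fun I => (t I).1.2) fun I => (t I).2).map
      e.symm.toRingHom
  have hle : Nat.card T ≤ Nat.card {w : R2 m × R2 m // w.1 ∈ Jm m ∧ w.2 ∈ Jm m ∧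
          dimCab m w.1 w.2 = m - 1} := by
    refine Nat.card_le_card_of_injective (fun t => ⟨(psi m (A t), psi m (B t)), psi_mem _ _,
      psi_mem _ _, card_Cab m hmpos _ _ (hAB t)⟩) ?_
    intro s t hst
    have h0 := congrArg Subtype.val hst
    have h1 := e.symm.injective (psi_inj m (congrArg Prod.fst h0))
    have h2 := e.symm.injective (psi_inj m (congrArg Prod.snd h0))
    funext I
    exact Subtype.ext (Prod.ext (congrFun h1 I) (congrFun h2 I))
  refine le_trans ?_ (Nat.cast_le.2 hle)
  rw [hT, Nat.cast_prod]
  set x : ℝ := 1 - (2 : ℝ) ^ (-(2 * (ell m : ℝ))) with hx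
  have hx0 : 0 ≤ x := by
    rw [hx, sub_nonneg]
    exact Real.rpow_le_one_of_one_le_of_nonpos (by norm_num) (by simp)
  have hx1 : x ≤ 1 := by
    rw [hx]
    have : (0 : ℝ) < (2 : ℝ) ^ (-(2 * (ell m : ℝ))) := by positivity
    linarith
  have hfac : ∀ I, (2 : ℝ) ^ (2 * (p I).natDegree) * x
      ≤ (((2 ^ (p I).natDegree) ^ 2 - 1 : ℕ) : ℝ) := by
    intro I
    rw [Nat.cast_sub (Nat.one_le_pow _ _ (by positivity)), hx, mul_sub, mul_one]
    push_cast
    rw [← pow_mul, mul_comm 2 (p I).natDegree]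
    have h1 : (2 : ℝ) ^ ((p I).natDegree * 2) * (2 : ℝ) ^ (-(2 * (ell m : ℝ))) ≥ 1 := by
      rw [← Real.rpow_natCast, ← Real.rpow_add (by norm_num)]
      refine Real.one_le_rpow (by norm_num) ?_
      have : (ell m : ℝ) ≤ (p I).natDegree := by exact_mod_cast ell_le m _ (hirr I) (hdvd I)
      push_cast
      linarith
    linarith
  have hpr := Finset.prod_le_prod (s := Finset.univ)
    (fun I _ => mul_nonneg (by positivity) hx0) (fun I _ => hfac I)
  refine le_trans ?_ hpr
  rw [Finset.prod_mul_distrib, Finset.prod_pow_eq_pow_sum, ← Finset.mul_sum, hsum,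
    Finset.prod_const]
  refine mul_le_mul_of_nonneg_left ?_ (by positivity)
  rcases isEmpty_or_nonempty (MaximalSpectrum (Sq m)) with hE | ⟨⟨I⟩⟩
  · rw [Finset.univ_eq_empty, Finset.card_empty, pow_zero]
    exact Real.rpow_le_one hx0 hx1 (by positivity)
  · have hl := ell_pos m _ (hirr I) (hdvd I)
    have hl' : (0 : ℝ) < ell m := by exact_mod_cast hl
    have hxpos : 0 < x := by
      rw [hx, sub_pos]
      exact Real.rpow_lt_one_of_one_lt_of_neg (by norm_num) (by linarith)
    rw [← Real.rpow_natCast]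
    refine Real.rpow_le_rpow_of_exponent_ge hxpos hx1 ?_
    rw [le_div_iff₀ hl']
    have : (Finset.univ : Finset (MaximalSpectrum (Sq m))).card * ell m ≤ m := by
      have := Finset.card_nsmul_le_sum Finset.univ (fun I => (p I).natDegree) (ell m)
        (fun I _ => ell_le m _ (hirr I) (hdvd I))
      rw [hsum, smul_eq_mul] at this
      omega
    exact_mod_cast this

end
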